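/- arXiv:2007.09017 — 2 statements merged into one kernel-verified Lean document; each statement's English description precedes it below -/
import Mathlib

section
/- Let 𝒞 be a set of cost functions that is closed under composition and consistent for unweighted resource graph games. Then for every c ∈ 𝒞 with c : ℤ_{≥0}^m → ℝ^m, for all r, s ∈ {1,…,m} with r ≠ s and all x ∈ ℤ_{≥0}^m with x_r > 0, it holds that c_r(x + 1_s) − c_r(x) = c_r(x + 1_{{r,s}}) − c_r(x + 1_r). -/
open Finset

/-- The indicator vector of a set `S` of resources. -/
def indicVec {m : ℕ} (S : Finset (Fin m)) : Fin m → ℕ :=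
  fun r => if r ∈ S then 1 else 0

/-- The load vector induced by a strategy profile `x`. -/
def loadVec {n m : ℕ} (x : Fin n → Fin m → ℕ) : Fin m → ℕ :=
  fun r => ∑ i, x i r

/-- The private cost of player `i` in profile `x` with cost function `c`. -/
def playerCost {n m : ℕ} (c : (Fin m → ℕ) → Fin m → ℝ)
    (x : Fin n → Fin m → ℕ) (i : Fin n) : ℝ :=
  ∑ r, (x i r : ℝ) * c (loadVec x) r

/-- `X` is a valid system of strategy sets for an unweighted resource graph game:
each `X i` is a nonempty finite set of `0/1`-vectors. -/
def IsStrategySets {n m : ℕ} (X : Fin n → Finset (Fin m → ℕ)) : Prop :=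
  (∀ i, (X i).Nonempty) ∧ ∀ i, ∀ v ∈ X i, ∀ r, v r ≤ 1

/-- `x` is a pure Nash equilibrium of the unweighted resource graph game with
strategy sets `X` and cost function `c`. -/
def IsPNE {n m : ℕ} (c : (Fin m → ℕ) → Fin m → ℝ)
    (X : Fin n → Finset (Fin m → ℕ)) (x : Fin n → Fin m → ℕ) : Prop :=
  (∀ i, x i ∈ X i) ∧
    ∀ i, ∀ y ∈ X i, playerCost c x i ≤ playerCost c (Function.update x i y) i

/-- The composition `c ⊕ c'` of two cost functions. -/
def oplus {m m' : ℕ} (c : (Fin m → ℕ) → Fin m → ℝ)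
    (c' : (Fin m' → ℕ) → Fin m' → ℝ) :
    (Fin (m + m') → ℕ) → Fin (m + m') → ℝ :=
  fun x => Fin.addCases (motive := fun _ => ℝ)
    (fun i => c (fun j => x (Fin.castAdd m' j)) i)
    (fun i => c' (fun j => x (Fin.natAdd m j)) i)

/-- A set of cost functions, one set for each number `m` of resources. -/
abbrev CostFamily := (m : ℕ) → Set ((Fin m → ℕ) → Fin m → ℝ)

/-- `𝒞` is closed under composition. -/
def ClosedUnderComposition (𝒞 : CostFamily) : Prop :=
  ∀ m m' : ℕ, ∀ c ∈ 𝒞 m, ∀ c' ∈ 𝒞 m', oplus c c' ∈ 𝒞 (m + m')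

/-- `𝒞` is consistent for unweighted resource graph games: every unweighted
resource graph game whose cost function belongs to `𝒞` has a pure Nash equilibrium. -/
def Consistent (𝒞 : CostFamily) : Prop :=
  ∀ m : ℕ, ∀ c ∈ 𝒞 m, ∀ n : ℕ, ∀ X : Fin n → Finset (Fin m → ℕ),
    IsStrategySets X → ∃ x, IsPNE c X x

/-- The cost of a strategy `u` under the load vector `w`. -/
def strategyCost {m : ℕ} (c : (Fin m → ℕ) → Fin m → ℝ) (u w : Fin m → ℕ) : ℝ :=
  ∑ r, (u r : ℝ) * c w r

theorem strategyCost_indicVec {m : ℕ} (c : (Fin m → ℕ) → Fin m → ℝ) (S : Finset (Fin m))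
    (w : Fin m → ℕ) : strategyCost c (indicVec S) w = ∑ r ∈ S, c w r := by
  simp [strategyCost, indicVec, Finset.sum_ite_mem]

theorem strategyCost_zero {m : ℕ} (c : (Fin m → ℕ) → Fin m → ℝ) (w : Fin m → ℕ) :
    strategyCost c 0 w = 0 := by
  simp [strategyCost]

theorem strategyCost_oplus_append {m m' : ℕ} (c : (Fin m → ℕ) → Fin m → ℝ)
    (c' : (Fin m' → ℕ) → Fin m' → ℝ) (u w : Fin m → ℕ) (u' w' : Fin m' → ℕ) :
    strategyCost (oplus c c') (Fin.append u u') (Fin.append w w')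
      = strategyCost c u w + strategyCost c' u' w' := by
  simp [strategyCost, oplus, Fin.sum_univ_add]

theorem append_add_append {m m' : ℕ} (u v : Fin m → ℕ) (u' v' : Fin m' → ℕ) :
    Fin.append u u' + Fin.append v v' = Fin.append (u + v) (u' + v') := by
  ext i
  refine Fin.addCases (fun j => ?_) (fun j => ?_) i <;> simp

theorem append_le_one {m m' : ℕ} {u : Fin m → ℕ} {u' : Fin m' → ℕ}
    (hu : ∀ i, u i ≤ 1) (hu' : ∀ i, u' i ≤ 1) (i : Fin (m + m')) :
    Fin.append u u' i ≤ 1 := by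
  refine Fin.addCases (fun j => ?_) (fun j => ?_) i <;> simp [hu, hu']

theorem indicVec_le_one {m : ℕ} (S : Finset (Fin m)) (i : Fin m) : indicVec S i ≤ 1 := by
  unfold indicVec
  split <;> simp

/-- Any load vector is induced by players that have a single strategy. -/
theorem exists_loadVec_eq {m : ℕ} (z : Fin m → ℕ) :
    ∃ (k : ℕ) (d : Fin k → Fin m → ℕ), (∀ i r, d i r ≤ 1) ∧ loadVec d = z := by
  refine ⟨∑ r, z r, fun i r => if (i : ℕ) < z r then 1 else 0, fun i r => ?_, ?_⟩
  · dsimp only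
    split <;> simp
  · ext r
    have h : z r ≤ ∑ r, z r := Finset.single_le_sum (fun _ _ => Nat.zero_le _) (mem_univ r)
    rw [loadVec, Fin.sum_univ_eq_sum_range (fun i => if i < z r then 1 else 0),
      Finset.sum_boole]
    have : (range (∑ r, z r)).filter (· < z r) = range (z r) := by
      ext i
      simp only [mem_filter, mem_range]
      omega
    simp [this]

/-- In a consistent family, two-player games on top of a fixed load have an equilibrium. -/
theorem Consistent.exists_two_player_equilibrium {𝒞 : CostFamily} (hcons : Consistent 𝒞)
    {m : ℕ} {c : (Fin m → ℕ) → Fin m → ℝ} (hc : c ∈ 𝒞 m) (z : Fin m → ℕ)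
    {A B : Finset (Fin m → ℕ)} (hA : A.Nonempty) (hB : B.Nonempty)
    (hA1 : ∀ a ∈ A, ∀ r, a r ≤ 1) (hB1 : ∀ b ∈ B, ∀ r, b r ≤ 1) :
    ∃ a ∈ A, ∃ b ∈ B,
      (∀ a' ∈ A, strategyCost c a (z + (a + b)) ≤ strategyCost c a' (z + (a' + b))) ∧
      (∀ b' ∈ B, strategyCost c b (z + (a + b)) ≤ strategyCost c b' (z + (a + b'))) := by
  obtain ⟨k, d, hd1, rfl⟩ := exists_loadVec_eq z
  let X : Fin (k + 2) → Finset (Fin m → ℕ) := Fin.cons A (Fin.cons B fun i => {d i})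
  have hX : IsStrategySets X := by
    refine ⟨fun i => ?_, fun i => ?_⟩
    · refine Fin.cases hA (fun i => ?_) i
      refine Fin.cases hB (fun i => ?_) i
      simp [X]
    · refine Fin.cases hA1 (fun i => ?_) i
      refine Fin.cases hB1 (fun i => ?_) i
      simpa [X] using hd1 i
  obtain ⟨x, hxX, hx⟩ := hcons m c hc _ X hX
  have hload (y : Fin (k + 2) → Fin m → ℕ) (hy : ∀ i : Fin k, y i.succ.succ = d i) :
      loadVec y = loadVec d + (y 0 + y 1) := by
    ext r
    simp [loadVec, Fin.sum_univ_succ, hy]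
    ring
  have hxd (i : Fin k) : x i.succ.succ = d i := by
    simpa [X] using hxX i.succ.succ
  refine ⟨x 0, hxX 0, x 1, hxX 1, fun a' ha' => ?_, fun b' hb' => ?_⟩
  · have h := hx 0 a' ha'
    have hl := hload (Function.update x 0 a') fun i => by
      rw [Function.update_of_ne (Fin.succ_ne_zero _), hxd]
    simpa [playerCost, strategyCost, hl, hload x hxd] using h
  · have h := hx 1 b' hb'
    have hl := hload (Function.update x 1 b') fun i => by
      rw [Function.update_of_ne (by simp [Fin.ext_iff]), hxd]
    simpa [playerCost, strategyCost, hl, hload x hxd] using h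

/-- For two players adding load on `S` and on `T`, the externalities they impose on each other
are equal. -/
theorem Consistent.externality_symm {𝒞 : CostFamily} (hcons : Consistent 𝒞)
    (hcomp : ClosedUnderComposition 𝒞) {m : ℕ} {c : (Fin m → ℕ) → Fin m → ℝ} (hc : c ∈ 𝒞 m)
    (S T : Finset (Fin m)) (z : Fin m → ℕ) :
    ∑ i ∈ S, c (z + (indicVec S + indicVec T)) i - ∑ i ∈ S, c (z + indicVec S) i
      = ∑ i ∈ T, c (z + (indicVec S + indicVec T)) i - ∑ i ∈ T, c (z + indicVec T) i := by
  have hc2 := hcomp _ _ c hc c hc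
  have hc4 := hcomp _ _ _ hc2 _ hc2
  let vec (u₁ u₂ u₃ u₄ : Fin m → ℕ) := Fin.append (Fin.append u₁ u₂) (Fin.append u₃ u₄)
  have hvec {u₁ u₂ u₃ u₄ : Fin m → ℕ} (h₁ : ∀ i, u₁ i ≤ 1) (h₂ : ∀ i, u₂ i ≤ 1)
      (h₃ : ∀ i, u₃ i ≤ 1) (h₄ : ∀ i, u₄ i ≤ 1) : ∀ i, vec u₁ u₂ u₃ u₄ i ≤ 1 :=
    append_le_one (append_le_one h₁ h₂) (append_le_one h₃ h₄)
  have h0 (i : Fin m) : (0 : Fin m → ℕ) i ≤ 1 := by simp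
  have hS := indicVec_le_one S
  have hT := indicVec_le_one T
  obtain ⟨a, ha, b, hb, hab, hba⟩ := hcons.exists_two_player_equilibrium hc4 (vec z z z z)
    (A := {vec (indicVec S) 0 (indicVec T) 0, vec 0 (indicVec S) 0 (indicVec T)})
    (B := {vec (indicVec T) 0 0 (indicVec S), vec 0 (indicVec T) (indicVec S) 0})
    (by simp) (by simp)
    (by simpa using ⟨hvec hS h0 hT h0, hvec h0 hS h0 hT⟩)
    (by simpa using ⟨hvec hT h0 h0 hS, hvec h0 hT hS h0⟩)
  simp only [mem_insert, mem_singleton, forall_eq_or_imp, forall_eq] at ha hb hab hba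
  rcases ha with rfl | rfl <;> rcases hb with rfl | rfl <;>
  · simp only [vec, append_add_append, strategyCost_oplus_append, strategyCost_zero,
      strategyCost_indicVec, add_zero, zero_add, le_refl, true_and, and_true,
      add_comm (indicVec T) (indicVec S)] at hab hba
    linarith

/-- Lemma (part (a)): for consistent, composition-closed sets of cost functions,
the effect of resource `s` on resource `r` does not depend on an extra unit of load on `r`. -/
theorem hesse_offdiag_unweighted_a (𝒞 : CostFamily)
    (hcomp : ClosedUnderComposition 𝒞) (hcons : Consistent 𝒞)
    (m : ℕ) (c : (Fin m → ℕ) → Fin m → ℝ) (hc : c ∈ 𝒞 m)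
    (r s : Fin m) (hrs : r ≠ s) (x : Fin m → ℕ) (hx : 0 < x r) :
    c (x + indicVec {s}) r - c x r
      = c (x + indicVec {r, s}) r - c (x + indicVec {r}) r := by
  have hpair : (indicVec {r, s} : Fin m → ℕ) = indicVec {r} + indicVec {s} := by
    ext i
    by_cases hr : i = r <;> by_cases hs : i = s <;> simp_all [indicVec]
  obtain ⟨z, rfl⟩ : ∃ z, x = z + indicVec {r} := by
    refine ⟨x - indicVec {r}, ?_⟩
    ext i
    by_cases hi : i = r
    · subst hi
      simp [indicVec]
      omega
    · simp [indicVec, hi]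
  have h₁ := hcons.externality_symm hcomp hc {r} {r, s} z
  have h₂ := hcons.externality_symm hcomp hc {r} {s} (z + indicVec {r})
  simp only [sum_singleton, sum_pair hrs, hpair, ← add_assoc] at h₁ h₂ ⊢
  linarith
end

section
/- Let 𝒞 be a set of cost functions that is closed under composition and consistent for unweighted resource graph games. Then for every c ∈ 𝒞 with c : ℤ_{≥0}^m → ℝ^m, for all r, s ∈ {1,…,m} with r ≠ s and all x ∈ ℤ_{≥0}^m with x_r > 0, it holds that c_r(x + 2·1_s) − c_r(x + 1_s) = c_r(x + 1_s) − c_r(x). -/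
open Finset

/-- The cost of a player choosing `u` when one opponent chooses `v` and all other players
together induce the load `y`. -/
def duelCost {m : ℕ} (c : (Fin m → ℕ) → Fin m → ℝ) (y u v : Fin m → ℕ) : ℝ :=
  ∑ r, (u r : ℝ) * c (u + v + y) r

theorem duelCost_zero_left {m : ℕ} (c : (Fin m → ℕ) → Fin m → ℝ) (y v : Fin m → ℕ) :
    duelCost c y 0 v = 0 := by
  simp [duelCost]

theorem oplus_append {m m' : ℕ} (c : (Fin m → ℕ) → Fin m → ℝ)
    (c' : (Fin m' → ℕ) → Fin m' → ℝ) (a : Fin m → ℕ) (a' : Fin m' → ℕ) :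
    oplus c c' (Fin.append a a') = Fin.append (c a) (c' a') := by
  ext i
  refine Fin.addCases (fun j => ?_) (fun j => ?_) i <;> simp [oplus]

theorem append_add_append_s6 {m m' : ℕ} (a b : Fin m → ℕ) (a' b' : Fin m' → ℕ) :
    Fin.append a a' + Fin.append b b' = Fin.append (a + b) (a' + b') := by
  ext i
  refine Fin.addCases (fun j => ?_) (fun j => ?_) i <;> simp

theorem append_le_one_s6 {m m' : ℕ} {a : Fin m → ℕ} {a' : Fin m' → ℕ} (ha : a ≤ 1) (ha' : a' ≤ 1) :
    Fin.append a a' ≤ 1 := by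
  intro i
  refine Fin.addCases (fun j => ?_) (fun j => ?_) i
  · simpa using ha j
  · simpa using ha' j

theorem duelCost_oplus {m m' : ℕ} (c : (Fin m → ℕ) → Fin m → ℝ)
    (c' : (Fin m' → ℕ) → Fin m' → ℝ) (y u v : Fin m → ℕ) (y' u' v' : Fin m' → ℕ) :
    duelCost (oplus c c') (Fin.append y y') (Fin.append u u') (Fin.append v v') =
      duelCost c y u v + duelCost c' y' u' v' := by
  simp [duelCost, append_add_append_s6, oplus_append, Fin.sum_univ_add]

/-- Every load vector is induced by finitely many players with a fixed `0/1`-strategy. -/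
theorem exists_sum_eq_of_le_one {m : ℕ} (y : Fin m → ℕ) :
    ∃ (K : ℕ) (d : Fin K → Fin m → ℕ), (∀ k, d k ≤ 1) ∧ ∀ r, ∑ k, d k r = y r := by
  refine ⟨∑ r, y r, fun k r => if (k : ℕ) < y r then 1 else 0, fun k r => ?_, fun r => ?_⟩
  · dsimp only
    split_ifs <;> simp
  · have hle : y r ≤ ∑ r, y r := Finset.single_le_sum (fun _ _ => Nat.zero_le _) (mem_univ r)
    rw [Fin.sum_univ_eq_sum_range (fun k => if k < y r then 1 else 0), Finset.sum_boole]
    have : (range (∑ r, y r)).filter (fun k => k < y r) = range (y r) := by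
      ext k
      simp only [mem_filter, mem_range]
      omega
    simp [this]

/-- Every two-player game with two strategies per player on top of a fixed base load has a
pure Nash equilibrium. -/
theorem Consistent.exists_duel_equilibrium {𝒞 : CostFamily} (hcons : Consistent 𝒞) {m : ℕ}
    {c : (Fin m → ℕ) → Fin m → ℝ} (hc : c ∈ 𝒞 m) (y : Fin m → ℕ) {p p' q q' : Fin m → ℕ}
    (hp : p ≤ 1) (hp' : p' ≤ 1) (hq : q ≤ 1) (hq' : q' ≤ 1) :
    ∃ u v, (u = p ∨ u = p') ∧ (v = q ∨ v = q') ∧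
      (duelCost c y u v ≤ duelCost c y p v ∧ duelCost c y u v ≤ duelCost c y p' v) ∧
      (duelCost c y v u ≤ duelCost c y q u ∧ duelCost c y v u ≤ duelCost c y q' u) := by
  obtain ⟨K, d, hd, hsum⟩ := exists_sum_eq_of_le_one y
  let X : Fin (K + 2) → Finset (Fin m → ℕ) :=
    Fin.cons {p, p'} (Fin.cons {q, q'} fun k => {d k})
  have hX : IsStrategySets X := by
    refine ⟨fun i => ?_, fun i => ?_⟩
    · refine Fin.cases ?_ (fun j => Fin.cases ?_ (fun k => ?_) j) i <;> simp [X]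
    · refine Fin.cases ?_ (fun j => Fin.cases ?_ (fun k => ?_) j) i
      · intro v hv
        obtain rfl | rfl : v = p ∨ v = p' := by simpa [X] using hv
        exacts [hp, hp']
      · intro v hv
        obtain rfl | rfl : v = q ∨ v = q' := by simpa [X] using hv
        exacts [hq, hq']
      · intro v hv
        obtain rfl : v = d k := by simpa [X] using hv
        exact hd k
  obtain ⟨x, hxX, hx⟩ := hcons m c hc (K + 2) X hX
  have hx0 : x 0 = p ∨ x 0 = p' := by simpa [X] using hxX 0
  have hx1 : x 1 = q ∨ x 1 = q' := by
    have h : x 1 ∈ ({q, q'} : Finset (Fin m → ℕ)) := hxX (Fin.succ 0)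
    simpa using h
  have hxd (k : Fin K) : x k.succ.succ = d k := by
    have := hxX k.succ.succ
    simpa only [X, Fin.cons_succ, mem_singleton] using this
  have hload (z : Fin (K + 2) → Fin m → ℕ) (hz : ∀ k : Fin K, z k.succ.succ = d k) :
      loadVec z = z 0 + z 1 + y := by
    ext r
    simp [loadVec, Fin.sum_univ_succ, hz, hsum, add_assoc]
  have hcost0 (z : Fin (K + 2) → Fin m → ℕ) (hz : ∀ k : Fin K, z k.succ.succ = d k) :
      playerCost c z 0 = duelCost c y (z 0) (z 1) := by
    simp only [playerCost, duelCost, hload z hz]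
  have hcost1 (z : Fin (K + 2) → Fin m → ℕ) (hz : ∀ k : Fin K, z k.succ.succ = d k) :
      playerCost c z 1 = duelCost c y (z 1) (z 0) := by
    simp only [playerCost, duelCost, hload z hz, add_comm (z 0)]
  have h0 (w : Fin m → ℕ) (hw : w = p ∨ w = p') :
      duelCost c y (x 0) (x 1) ≤ duelCost c y w (x 1) := by
    have h := hx 0 w (by simpa [X] using hw)
    rw [hcost0 x hxd, hcost0 _ fun k => by
      rw [Function.update_of_ne (Fin.succ_ne_zero _), hxd]] at h
    simpa using h
  have h1 (w : Fin m → ℕ) (hw : w = q ∨ w = q') :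
      duelCost c y (x 1) (x 0) ≤ duelCost c y w (x 0) := by
    have h := hx 1 w (show w ∈ X (Fin.succ 0) by
      simpa only [X, Fin.cons_succ, Fin.cons_zero, mem_insert, mem_singleton] using hw)
    rw [hcost1 x hxd, hcost1 _ fun k => by
      rw [Function.update_of_ne (by simp [Fin.ext_iff]), hxd]] at h
    simpa using h
  exact ⟨x 0, x 1, hx0, hx1, ⟨h0 p (.inl rfl), h0 p' (.inr rfl)⟩, h1 q (.inl rfl), h1 q' (.inr rfl)⟩

/-- The cost increase that `v` imposes on `u` equals the one that `u` imposes on `v`. -/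
theorem duelCost_sub_symm {𝒞 : CostFamily} (hcomp : ClosedUnderComposition 𝒞)
    (hcons : Consistent 𝒞) {m : ℕ} {c : (Fin m → ℕ) → Fin m → ℝ} (hc : c ∈ 𝒞 m)
    (y : Fin m → ℕ) {u v : Fin m → ℕ} (hu : u ≤ 1) (hv : v ≤ 1) :
    duelCost c y u v - duelCost c y u 0 = duelCost c y v u - duelCost c y v 0 := by
  have hc2 := hcomp m m c hc c hc
  have hc4 := hcomp _ _ _ hc2 _ hc2
  have h0 : (0 : Fin m → ℕ) ≤ 1 := zero_le_one
  let four (a b e f : Fin m → ℕ) := Fin.append (Fin.append a b) (Fin.append e f)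
  have hfour {a b e f : Fin m → ℕ} (ha : a ≤ 1) (hb : b ≤ 1) (he : e ≤ 1) (hf : f ≤ 1) :
      four a b e f ≤ 1 := append_le_one_s6 (append_le_one_s6 ha hb) (append_le_one_s6 he hf)
  obtain ⟨_, _, rfl | rfl, rfl | rfl, ⟨h1, h2⟩, h3, h4⟩ :=
    hcons.exists_duel_equilibrium hc4 (four y y y y)
      (hfour hu h0 hv h0) (hfour h0 hu h0 hv) (hfour hv h0 h0 hu) (hfour h0 hv hu h0) <;>
  · simp only [four, duelCost_oplus, duelCost_zero_left] at h1 h2 h3 h4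
    linarith

/-- Lemma (part (b)): for consistent, composition-closed sets of cost functions,
the effect of the load of resource `s` on the cost of resource `r` is linear. -/
theorem hesse_offdiag_unweighted_b (𝒞 : CostFamily)
    (hcomp : ClosedUnderComposition 𝒞) (hcons : Consistent 𝒞)
    (m : ℕ) (c : (Fin m → ℕ) → Fin m → ℝ) (hc : c ∈ 𝒞 m)
    (r s : Fin m) (hrs : r ≠ s) (x : Fin m → ℕ) (hx : 0 < x r) :
    c (x + 2 • indicVec {s}) r - c (x + indicVec {s}) r
      = c (x + indicVec {s}) r - c x r := by
  obtain ⟨y, rfl⟩ : ∃ y, x = y + indicVec {r} := by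
    refine ⟨x - indicVec {r}, (tsub_add_cancel_of_le fun i => ?_).symm⟩
    by_cases h : i = r
    · subst h
      simpa [indicVec, Nat.one_le_iff_ne_zero, Nat.pos_iff_ne_zero] using hx
    · simp [indicVec, h]
  have hind (S : Finset (Fin m)) : indicVec S ≤ 1 := fun i => by
    by_cases h : i ∈ S <;> simp [indicVec, h]
  have hpair : indicVec {r, s} = indicVec {r} + indicVec {s} := by
    ext i
    by_cases hr : i = r
    · subst hr
      simp [indicVec, hrs]
    · simp [indicVec, hr]
  have hsingle (t : Fin m) (w : Fin m → ℕ) :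
      duelCost c y (indicVec {t}) w = c (indicVec {t} + w + y) t := by
    simp [duelCost, indicVec]
  have hdouble (w : Fin m → ℕ) : duelCost c y (indicVec {r} + indicVec {s}) w =
      c (indicVec {r} + indicVec {s} + w + y) r + c (indicVec {r} + indicVec {s} + w + y) s := by
    simp [duelCost, indicVec, add_mul, Finset.sum_add_distrib]
  have h1 := duelCost_sub_symm hcomp hcons hc y (hind {r}) (hind {s})
  have h2 := duelCost_sub_symm hcomp hcons hc y (hind {r, s}) (hind {s})
  simp only [hpair, hsingle, hdouble, add_zero] at h1 h2
  generalize indicVec {r} = a at *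
  generalize indicVec {s} = b at *
  rw [show y + a + 2 • b = a + b + b + y by rw [two_nsmul]; abel,
    show y + a + b = a + b + y by abel, add_comm y a]
  rw [add_comm b a] at h1
  rw [show b + (a + b) + y = a + b + b + y by abel] at h2
  linarith
end
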